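/- Let V be a dissipative quadratic stochastic operator on S^{m-1} with coefficients satisfying p_{ii,1} = 1 for all i ≠ 2 and p_{22,2} = 1. Then every point x_λ = λe_1 + (1−λ)e_2 with 0 ≤ λ ≤ 1 is a fixed point of V; in particular V has infinitely many fixed points. -/

import Mathlib

open Finset Filter Topology

/-- Membership in the simplex `S^{m-1}`. -/
def InSimplex {m : ℕ} (x : Fin m → ℝ) : Prop :=
  (∀ i, 0 ≤ x i) ∧ ∑ i, x i = 1

/-- The decreasing rearrangement `x↓` of a vector. -/
noncomputable def dsort {m : ℕ} (x : Fin m → ℝ) : Fin m → ℝ :=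
  fun i => x (Tuple.sort x i.rev)

/-- The sum of the `k` largest coordinates of `x`. -/
noncomputable def topSum {m : ℕ} (x : Fin m → ℝ) (k : ℕ) : ℝ :=
  ∑ i ∈ Finset.univ.filter (fun i : Fin m => (i : ℕ) < k), dsort x i

/-- `Maj x y` means `x ≺ y` : `x` is majorized by `y`. -/
def Maj {m : ℕ} (x y : Fin m → ℝ) : Prop :=
  (∀ k, 1 ≤ k → k ≤ m - 1 → topSum x k ≤ topSum y k) ∧ ∑ i, x i = ∑ i, y i

/-- The `k`-th vertex of the simplex. -/
def vertex {m : ℕ} (k : Fin m) : Fin m → ℝ := fun i => if i = k then 1 else 0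

/-- The quadratic stochastic operator associated to coefficients `p`. -/
def qso {m : ℕ} (p : Fin m → Fin m → Fin m → ℝ) (x : Fin m → ℝ) : Fin m → ℝ :=
  fun k => ∑ i, ∑ j, p i j k * x i * x j

/-- Conditions on the heredity coefficients of a q.s.o. -/
def IsQSO {m : ℕ} (p : Fin m → Fin m → Fin m → ℝ) : Prop :=
  (∀ i j k, 0 ≤ p i j k) ∧ (∀ i j k, p i j k = p j i k) ∧ (∀ i j, ∑ k, p i j k = 1)

lemma topSum_one {n : ℕ} (x : Fin (n + 1) → ℝ) :
    topSum x 1 = x (Tuple.sort x (Fin.last n)) := by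
  have hf : Finset.univ.filter (fun i : Fin (n + 1) => (i : ℕ) < 1) = {0} := by
    ext i
    rw [Finset.mem_filter, Finset.mem_singleton, Fin.ext_iff, Fin.val_zero, Nat.lt_one_iff]
    exact and_iff_right (Finset.mem_univ i)
  rw [topSum, hf, Finset.sum_singleton, dsort, Fin.rev_zero]

lemma le_topSum_one {m : ℕ} (x : Fin m → ℝ) (j : Fin m) : x j ≤ topSum x 1 := by
  obtain ⟨n, rfl⟩ : ∃ n, m = n + 1 := ⟨m - 1, by have := j.2; omega⟩
  have h := Tuple.monotone_sort x (Fin.le_last ((Tuple.sort x).symm j))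
  simpa [topSum_one] using h

lemma exists_topSum_one_eq {m : ℕ} (hm : 0 < m) (x : Fin m → ℝ) : ∃ i, topSum x 1 = x i := by
  obtain ⟨n, rfl⟩ : ∃ n, m = n + 1 := ⟨m - 1, by omega⟩
  exact ⟨_, topSum_one x⟩

lemma inSimplex_edge {m : ℕ} (s t : Fin m) {l : ℝ} (h0 : 0 ≤ l) (h1 : l ≤ 1) :
    InSimplex (fun i => l * vertex s i + (1 - l) * vertex t i) := by
  refine ⟨fun i => ?_, ?_⟩
  · have : 0 ≤ 1 - l := by linarith
    unfold vertex
    positivity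
  · simp [vertex, Finset.sum_add_distrib]

lemma qso_edge {m : ℕ} {p : Fin m → Fin m → Fin m → ℝ} (hp : IsQSO p) (s t : Fin m)
    (l r : ℝ) (k : Fin m) :
    qso p (fun i => l * vertex s i + r * vertex t i) k =
      l ^ 2 * p s s k + 2 * l * r * p s t k + r ^ 2 * p t t k := by
  simp only [qso, vertex, mul_add, add_mul, Finset.sum_add_distrib, mul_ite, ite_mul, mul_one,
    mul_zero, zero_mul, Finset.sum_ite_eq', Finset.mem_univ, if_true]
  rw [hp.2.1 t s k]
  ring

lemma IsQSO.add_le_one {m : ℕ} {p : Fin m → Fin m → Fin m → ℝ} (hp : IsQSO p) (i j : Fin m)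
    {k l : Fin m} (hkl : k ≠ l) : p i j k + p i j l ≤ 1 := by
  rw [← hp.2.2 i j, ← Finset.sum_pair hkl]
  exact Finset.sum_le_sum_of_subset_of_nonneg (Finset.subset_univ _) fun _ _ _ => hp.1 _ _ _

lemma IsQSO.le_one {m : ℕ} {p : Fin m → Fin m → Fin m → ℝ} (hp : IsQSO p) (i j k : Fin m) :
    p i j k ≤ 1 := by
  rw [← hp.2.2 i j]
  exact Finset.single_le_sum (f := p i j) (fun _ _ => hp.1 _ _ _) (Finset.mem_univ k)

lemma IsQSO.eq_vertex {m : ℕ} {p : Fin m → Fin m → Fin m → ℝ} (hp : IsQSO p) {i j s : Fin m}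
    (h : p i j s = 1) (k : Fin m) : p i j k = vertex s k := by
  unfold vertex
  split_ifs with hk
  · rw [hk, h]
  · have := hp.add_le_one i j hk
    have := hp.1 i j k
    linarith

/-- Near the fixed vertex `s` the largest coordinate of the image is the `s`-th one, so
dissipativity bounds the mixed coefficient `p s t s` from below. -/
lemma half_le_of_dissipative {m : ℕ} (hm : 2 ≤ m) {p : Fin m → Fin m → Fin m → ℝ}
    (hp : IsQSO p) (hdiss : ∀ x, InSimplex x → Maj x (qso p x)) {s t : Fin m} (hst : s ≠ t)
    (hs : p s s s = 1) (ht : p t t t = 1) : 1 / 2 ≤ p s t s := by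
  have hx := inSimplex_edge s t (l := 9 / 10) (by norm_num) (by norm_num)
  have hmaj := (hdiss _ hx).1 1 le_rfl (by omega)
  obtain ⟨i, hi⟩ := exists_topSum_one_eq (by omega)
    (qso p fun i => 9 / 10 * vertex s i + (1 - 9 / 10) * vertex t i)
  have hle := le_topSum_one (fun i => 9 / 10 * vertex s i + (1 - 9 / 10) * vertex t i) s
  rw [hi, qso_edge hp, hp.eq_vertex hs, hp.eq_vertex ht] at hmaj
  have h := hle.trans hmaj
  by_cases his : i = s
  · subst his
    simp only [vertex, if_true, if_neg hst] at h
    linarith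
  · have h1 := hp.le_one s t i
    simp only [vertex, if_true, if_neg hst, if_neg his] at h
    split_ifs at h <;> linarith

theorem stmt11 (m : ℕ) (hm : 2 ≤ m) (p : Fin m → Fin m → Fin m → ℝ) (hp : IsQSO p)
    (hdiss : ∀ x, InSimplex x → Maj x (qso p x))
    (hii : ∀ i : Fin m, i ≠ ⟨1, by omega⟩ → p i i ⟨0, by omega⟩ = 1)
    (h22 : p ⟨1, by omega⟩ ⟨1, by omega⟩ ⟨1, by omega⟩ = 1) :
    (∀ lam : ℝ, 0 ≤ lam → lam ≤ 1 →
      qso p (fun i => lam * vertex (⟨0, by omega⟩ : Fin m) i +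
          (1 - lam) * vertex (⟨1, by omega⟩ : Fin m) i) =
        fun i => lam * vertex (⟨0, by omega⟩ : Fin m) i +
          (1 - lam) * vertex (⟨1, by omega⟩ : Fin m) i) ∧
      {x : Fin m → ℝ | InSimplex x ∧ qso p x = x}.Infinite := by
  have hne : (⟨0, by omega⟩ : Fin m) ≠ ⟨1, by omega⟩ := by simp
  have h11 := hii ⟨0, by omega⟩ hne
  generalize (⟨0, by omega⟩ : Fin m) = s at *
  generalize (⟨1, by omega⟩ : Fin m) = t at *
  have hs := half_le_of_dissipative hm hp hdiss hne h11 h22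
  have ht := half_le_of_dissipative hm hp hdiss hne.symm h22 h11
  rw [hp.2.1 t s t] at ht
  have hsum := hp.add_le_one s t hne
  have hmix : ∀ k, p s t k = 1 / 2 * vertex s k + 1 / 2 * vertex t k := by
    intro k
    by_cases hks : k = s
    · subst hks
      simp only [vertex, if_true, if_neg hne]
      linarith
    by_cases hkt : k = t
    · subst hkt
      simp only [vertex, if_true, if_neg hks]
      linarith
    have h3 : ∑ i ∈ {k, s, t}, p s t i ≤ ∑ i, p s t i :=
      Finset.sum_le_sum_of_subset_of_nonneg (Finset.subset_univ _) fun _ _ _ => hp.1 _ _ _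
    rw [hp.2.2, Finset.sum_insert (by simp [hks, hkt]), Finset.sum_pair hne] at h3
    have := hp.1 s t k
    simp only [vertex, if_neg hks, if_neg hkt]
    linarith
  have hfix : ∀ lam : ℝ, 0 ≤ lam → lam ≤ 1 →
      qso p (fun i => lam * vertex s i + (1 - lam) * vertex t i) =
        fun i => lam * vertex s i + (1 - lam) * vertex t i := by
    intro lam _ _
    funext k
    rw [qso_edge hp, hp.eq_vertex h11, hp.eq_vertex h22, hmix]
    ring
  refine ⟨hfix, ?_⟩
  refine Set.infinite_of_injOn_mapsTo
    (f := fun (lam : ℝ) i => lam * vertex s i + (1 - lam) * vertex t i)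
    (s := Set.Icc (0 : ℝ) 1) ?_ ?_ (Set.Icc_infinite one_pos)
  · intro a _ b _ hab
    simpa [vertex, hne] using congrFun hab s
  · exact fun l hl => ⟨inSimplex_edge s t hl.1 hl.2, hfix l hl.1 hl.2⟩
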